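/- arXiv:math/0308268 — 2 statements merged into one kernel-verified Lean document; each statement's English description precedes it below -/
import Mathlib

section
/- Let S = {x ∈ [0,1] : x ∉ ℚ} with the metric δ. For every x ∈ S and every r > 0, there is a Farey interval I = [p/q, p'/q'] contained in [0,1] such that the open ball {y ∈ S : δ(x,y) < r} is equal to I ∩ S, i.e. to I ∖ ℚ. -/
/-- The metric `δ` on the reals: for `x ≠ y`,
`δ(x,y) = sup {1/q : q ≥ 1, ∃ p ∈ ℤ, gcd(p,q) = 1, min x y ≤ p/q ≤ max x y}`,
and `δ(x,x) = 0`. -/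
noncomputable def deltamet (x y : ℝ) : ℝ :=
  if x = y then 0 else
    sSup {r : ℝ | ∃ q : ℕ, 0 < q ∧ (∃ p : ℤ, Int.gcd p q = 1 ∧
      min x y ≤ (p : ℝ) / q ∧ (p : ℝ) / q ≤ max x y) ∧ r = 1 / (q : ℝ)}

/-- `[p/q, p'/q']` is a Farey interval: `p/q < p'/q'` are irreducible fractions with
`p'q - pq' = 1`. -/
def IsFareyPair (p : ℤ) (q : ℕ) (p' : ℤ) (q' : ℕ) : Prop :=
  0 < q ∧ 0 < q' ∧ Int.gcd p q = 1 ∧ Int.gcd p' q' = 1 ∧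
    (p : ℝ) / q < (p' : ℝ) / q' ∧ p' * (q : ℤ) - p * (q' : ℤ) = 1

theorem one_div_le_deltamet {x y : ℝ} (hxy : x ≠ y) {p : ℤ} {q : ℕ} (hq : 0 < q)
    (hpq : Int.gcd p q = 1) (hmin : min x y ≤ (p : ℝ) / q) (hmax : (p : ℝ) / q ≤ max x y) :
    1 / (q : ℝ) ≤ deltamet x y := by
  rw [deltamet, if_neg hxy]
  refine le_csSup ⟨1, ?_⟩ ⟨q, hq, ⟨p, hpq, hmin, hmax⟩, rfl⟩
  rintro _ ⟨n, hn, -, rfl⟩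
  have : (1 : ℝ) ≤ n := by exact_mod_cast hn
  rw [div_le_one (by linarith)]
  exact this

theorem deltamet_le {x y c : ℝ} (hc : 0 ≤ c)
    (h : ∀ (p : ℤ) (q : ℕ), 0 < q → min x y ≤ (p : ℝ) / q → (p : ℝ) / q ≤ max x y →
      1 / (q : ℝ) ≤ c) :
    deltamet x y ≤ c := by
  rw [deltamet]
  split_ifs
  · exact hc
  · refine Real.sSup_le ?_ hc
    rintro _ ⟨q, hq, ⟨p, -, hmin, hmax⟩, rfl⟩
    exact h p q hq hmin hmax

theorem IsFareyPair.of_det {p p' : ℤ} {q q' : ℕ} (hq : 0 < q) (hq' : 0 < q')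
    (hdet : p' * (q : ℤ) - p * (q' : ℤ) = 1) : IsFareyPair p q p' q' := by
  refine ⟨hq, hq', ?_, ?_, ?_, hdet⟩
  · exact Int.isCoprime_iff_gcd_eq_one.1 ⟨-q', p', by linarith⟩
  · exact Int.isCoprime_iff_gcd_eq_one.1 ⟨q, -p, by linarith⟩
  · have : p * (q' : ℤ) < p' * q := by linarith
    rw [div_lt_div_iff₀ (by exact_mod_cast hq) (by exact_mod_cast hq')]
    exact_mod_cast this

/-- A fraction strictly inside a Farey interval has denominator at least the sum of the
denominators of the endpoints. -/
theorem IsFareyPair.add_le_of_lt_of_lt {p p' : ℤ} {q q' : ℕ} (h : IsFareyPair p q p' q')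
    {a : ℤ} {b : ℕ} (hb : 0 < b) (h₁ : (p : ℝ) / q < (a : ℝ) / b)
    (h₂ : (a : ℝ) / b < (p' : ℝ) / q') : q + q' ≤ b := by
  obtain ⟨hq, hq', -, -, -, hdet⟩ := h
  rw [div_lt_div_iff₀ (by exact_mod_cast hq) (by exact_mod_cast hb)] at h₁
  rw [div_lt_div_iff₀ (by exact_mod_cast hb) (by exact_mod_cast hq')] at h₂
  have h₁ : p * (b : ℤ) < a * q := by exact_mod_cast h₁
  have h₂ : a * (q' : ℤ) < p' * b := by exact_mod_cast h₂
  have hb_eq : (b : ℤ) = q * (p' * b - a * q') + q' * (a * q - p * b) := by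
    linear_combination (-(b : ℤ)) * hdet
  have hl : (q : ℤ) * 1 ≤ q * (p' * b - a * q') := by gcongr; linarith
  have hr : (q' : ℤ) * 1 ≤ q' * (a * q - p * b) := by gcongr; linarith
  omega

/-- An irrational number in `[0,1]` lies between consecutive Farey fractions of every order. -/
theorem exists_isFareyPair_of_irrational {x : ℝ} (hx : x ∈ Set.Icc (0 : ℝ) 1)
    (hxirr : Irrational x) {N : ℕ} (hN : 1 ≤ N) :
    ∃ (p p' : ℤ) (q q' : ℕ), IsFareyPair p q p' q' ∧ 0 ≤ (p : ℝ) / q ∧ (p' : ℝ) / q' ≤ 1 ∧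
      (p : ℝ) / q < x ∧ x < (p' : ℝ) / q' ∧ q ≤ N ∧ q' ≤ N ∧ N < q + q' := by
  induction N, hN using Nat.le_induction with
  | base =>
    refine ⟨0, 1, 1, 1, .of_det one_pos one_pos (by simp), by simp, by simp, ?_, ?_,
      le_rfl, le_rfl, by simp⟩
    · simpa using lt_of_le_of_ne hx.1 hxirr.ne_zero.symm
    · simpa using lt_of_le_of_ne hx.2 hxirr.ne_one
  | succ N _ ih =>
    obtain ⟨p, p', q, q', hF, h0, h1, hpx, hxp, hqN, hqN', hlt⟩ := ih
    by_cases hsum : N + 1 < q + q'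
    · exact ⟨p, p', q, q', hF, h0, h1, hpx, hxp, by omega, by omega, hsum⟩
    obtain ⟨hq, hq', -, -, -, hdet⟩ := hF
    have hne : x ≠ ((p + p' : ℤ) : ℝ) / (q + q' : ℕ) := by
      have := hxirr.ne_rat ((p + p' : ℤ) / (q + q' : ℕ))
      simpa using this
    rcases lt_or_gt_of_ne hne with hlt' | hgt
    · have hF' : IsFareyPair p q (p + p') (q + q') :=
        .of_det hq (by omega) (by push_cast; linarith)
      refine ⟨p, p + p', q, q + q', hF', h0, ?_, hpx, hlt', by omega, by omega, by omega⟩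
      have hq'R : (0 : ℝ) < q' := by exact_mod_cast hq'
      have hqR : (0 : ℝ) < q := by exact_mod_cast hq
      have hpq := hpx.trans_le hx.2
      rw [div_lt_one hqR] at hpq
      rw [div_le_one hq'R] at h1
      rw [div_le_one (by positivity)]
      push_cast
      linarith
    · have hF' : IsFareyPair (p + p') (q + q') p' q' :=
        .of_det (by omega) hq' (by push_cast; linarith)
      refine ⟨p + p', p', q + q', q', hF', ?_, h1, hgt, hxp, by omega, by omega, by omega⟩
      exact h0.trans (IsFareyPair.of_det hq (by omega : 0 < q + q')
        (by push_cast; linarith) : IsFareyPair p q (p + p') (q + q')).2.2.2.2.1.le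

theorem exists_nat_one_div_bracket {r : ℝ} (hr : 0 < r) :
    ∃ N : ℕ, 1 ≤ N ∧ 1 / ((N : ℝ) + 1) < r ∧ (N = 1 ∨ r ≤ 1 / (N : ℝ)) := by
  refine ⟨max 1 ⌊1 / r⌋₊, le_max_left _ _, ?_, ?_⟩
  · have h : 1 / r < (max 1 ⌊1 / r⌋₊ : ℕ) + 1 :=
      (Nat.lt_floor_add_one _).trans_le (by gcongr; exact le_max_right _ _)
    exact (one_div_lt hr (by positivity)).1 h
  · rcases le_total ⌊1 / r⌋₊ 1 with h | h
    · exact .inl (max_eq_left h)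
    · right
      rw [max_eq_right h]
      have := Nat.floor_le (one_div_pos.2 hr).le
      exact (le_one_div hr (by exact_mod_cast h)).2 this

/-- Every open `δ`-ball in `S = [0,1] ∖ ℚ` is the set of irrational points of a Farey
interval contained in `[0,1]`. -/
theorem ball_eq_fareyInterval (x : ℝ) (hx : x ∈ Set.Icc (0:ℝ) 1) (hxirr : Irrational x)
    (r : ℝ) (hr : 0 < r) :
    ∃ (p p' : ℤ) (q q' : ℕ), IsFareyPair p q p' q' ∧
      0 ≤ (p : ℝ) / q ∧ (p' : ℝ) / q' ≤ 1 ∧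
      {y : ℝ | y ∈ Set.Icc (0:ℝ) 1 ∧ Irrational y ∧ deltamet x y < r} =
        {y : ℝ | y ∈ Set.Icc ((p : ℝ) / q) ((p' : ℝ) / q') ∧ Irrational y} := by
  obtain ⟨N, hN, hNr, hrN⟩ := exists_nat_one_div_bracket hr
  obtain ⟨p, p', q, q', hF, h0, h1, hpx, hxp, hqN, hqN', hlt⟩ :=
    exists_isFareyPair_of_irrational hx hxirr hN
  refine ⟨p, p', q, q', hF, h0, h1, ?_⟩
  have separated {y : ℝ} (hy : y ∈ Set.Icc (0 : ℝ) 1) {a : ℤ} {b : ℕ} (hb : 0 < b) (hbN : b ≤ N)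
      (hab : Int.gcd a b = 1) (hne : x ≠ y) (hmin : min x y < (a : ℝ) / b)
      (hmax : (a : ℝ) / b < max x y) : r ≤ deltamet x y := by
    have hbR : (0 : ℝ) < b := by exact_mod_cast hb
    rcases hrN with rfl | hrN
    · obtain rfl : b = 1 := by omega
      have ha0 := (le_min hx.1 hy.1).trans_lt hmin
      have ha1 := hmax.trans_le (max_le hx.2 hy.2)
      simp only [Nat.cast_one, div_one] at ha0 ha1
      have : (0 : ℤ) < a := by exact_mod_cast ha0
      have : a < (1 : ℤ) := by exact_mod_cast ha1
      omega
    · calc r ≤ 1 / (N : ℝ) := hrN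
        _ ≤ 1 / (b : ℝ) := by gcongr
        _ ≤ deltamet x y := one_div_le_deltamet hne hb hab hmin.le hmax.le
  ext y
  constructor
  · rintro ⟨hy, hyirr, hlt_r⟩
    refine ⟨⟨?_, ?_⟩, hyirr⟩
    · by_contra! hyp
      exact hlt_r.not_ge (separated hy hF.1 hqN hF.2.2.1 (hyp.trans hpx).ne'
        (min_lt_of_right_lt hyp) (lt_max_of_lt_left hpx))
    · by_contra! hyp
      exact hlt_r.not_ge (separated hy hF.2.1 hqN' hF.2.2.2.1 (hxp.trans hyp).ne
        (min_lt_of_left_lt hxp) (lt_max_of_lt_right hyp))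
  · rintro ⟨⟨hpy, hyp⟩, hyirr⟩
    refine ⟨⟨h0.trans hpy, hyp.trans h1⟩, hyirr, lt_of_le_of_lt ?_ hNr⟩
    have hpy' : (p : ℝ) / q < y := hpy.lt_of_ne (by
      simpa using (hyirr.ne_rat (p / q)).symm)
    have hyp' : y < (p' : ℝ) / q' := hyp.lt_of_ne (by
      simpa using hyirr.ne_rat (p' / q'))
    refine deltamet_le (by positivity) fun a b hb hmin hmax => ?_
    have hle := hF.add_le_of_lt_of_lt hb ((lt_min hpx hpy').trans_le hmin)
      (hmax.trans_lt (max_lt hxp hyp'))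
    have : (N : ℝ) + 1 ≤ b := by exact_mod_cast (by omega : N + 1 ≤ b)
    gcongr
end

section
/- For all irrational real numbers x, y with 0 < x < y, one has δ(x/(x+1), y/(y+1)) = d(x, y). Consequently, the map x ↦ x/(x+1) is a bijective isometry from the metric space ({x ∈ ℝ : x > 0 and x ∉ ℚ}, d) onto the metric space ({x ∈ ℝ : 0 < x < 1 and x ∉ ℚ}, δ). -/
/-- The metric `d` on the reals: for `x ≠ y`,
`d(x,y) = sup {1/(|p|+q) : p ∈ ℤ, q ≥ 1, gcd(p,q) = 1, min x y ≤ p/q ≤ max x y}`,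
and `d(x,x) = 0`. -/
noncomputable def dmet (x y : ℝ) : ℝ :=
  if x = y then 0 else
    sSup {r : ℝ | ∃ (p : ℤ) (q : ℕ), 0 < q ∧ Int.gcd p q = 1 ∧
      min x y ≤ (p : ℝ) / q ∧ (p : ℝ) / q ≤ max x y ∧ r = 1 / (|(p : ℝ)| + q)}

theorem dmet_comm (x y : ℝ) : dmet x y = dmet y x := by
  simp only [dmet, min_comm x y, max_comm x y, eq_comm (a := x)]

theorem deltamet_comm (x y : ℝ) : deltamet x y = deltamet y x := by
  simp only [deltamet, min_comm x y, max_comm x y, eq_comm (a := x)]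

theorem div_add_one_le_div_add_iff {x p q : ℝ} (hx : 0 < x) (hq : 0 < q) (hpq : 0 < p + q) :
    x / (x + 1) ≤ p / (p + q) ↔ x ≤ p / q := by
  rw [div_le_div_iff₀ (by linarith) hpq, le_div_iff₀ hq]
  constructor <;> intro h <;> linarith

theorem div_add_le_div_add_one_iff {x p q : ℝ} (hx : 0 < x) (hq : 0 < q) (hpq : 0 < p + q) :
    p / (p + q) ≤ x / (x + 1) ↔ p / q ≤ x := by
  rw [div_le_div_iff₀ hpq (by linarith), div_le_iff₀ hq]
  constructor <;> intro h <;> linarith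

theorem deltamet_div_add_one {x y : ℝ} (hx : 0 < x) (hxy : x < y) :
    deltamet (x / (x + 1)) (y / (y + 1)) = dmet x y := by
  have hy : 0 < y := hx.trans hxy
  have hlt : x / (x + 1) < y / (y + 1) := by
    rw [div_lt_div_iff₀ (by linarith) (by linarith)]
    linarith
  rw [deltamet, dmet, if_neg hlt.ne, if_neg hxy.ne, min_eq_left hlt.le, max_eq_right hlt.le,
    min_eq_left hxy.le, max_eq_right hxy.le]
  congr 1
  ext r
  constructor
  · rintro ⟨n, hn, ⟨p, hgcd, h₁, h₂⟩, rfl⟩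
    have hn' : (0 : ℝ) < n := by exact_mod_cast hn
    have hp : (0 : ℝ) < p := by
      have h : 0 < (p : ℝ) / n := (by positivity : 0 < x / (x + 1)).trans_le h₁
      exact (div_pos_iff_of_pos_right hn').1 h
    have hpn : (p : ℝ) < n := by
      have h : (p : ℝ) / n < 1 := h₂.trans_lt ((div_lt_one (by linarith)).2 (by linarith))
      exact (div_lt_one hn').1 h
    have hpnZ : p < (n : ℤ) := by exact_mod_cast hpn
    obtain ⟨q, hq⟩ := Int.eq_ofNat_of_zero_le (sub_nonneg.2 hpnZ.le)
    have hnq : (n : ℤ) = p + q := by omega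
    have hnq' : (n : ℝ) = p + q := by exact_mod_cast hnq
    have hq0 : (0 : ℝ) < q := by linarith
    rw [hnq'] at h₁ h₂ hn'
    refine ⟨p, q, by omega, ?_, (div_add_one_le_div_add_iff hx hq0 hn').1 h₁,
      (div_add_le_div_add_one_iff hy hq0 hn').1 h₂, by rw [abs_of_pos hp, hnq']⟩
    simpa [hnq] using hgcd
  · rintro ⟨p, q, hq, hgcd, h₁, h₂, rfl⟩
    have hq0 : (0 : ℝ) < q := by exact_mod_cast hq
    have hp : (0 : ℝ) < p := (div_pos_iff_of_pos_right hq0).1 (hx.trans_le h₁)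
    have hpZ : 0 < p := by exact_mod_cast hp
    lift p to ℕ using hpZ.le
    rw [Int.cast_natCast] at *
    have hpq : (0 : ℝ) < p + q := by positivity
    refine ⟨p + q, by omega, ⟨p, by simpa using hgcd, ?_, ?_⟩, ?_⟩
    · simpa using (div_add_one_le_div_add_iff hx hq0 hpq).2 h₁
    · simpa using (div_add_le_div_add_one_iff hy hq0 hpq).2 h₂
    · rw [abs_of_pos hp, Nat.cast_add]

theorem div_add_one_div_one_sub {x : ℝ} (hx : 0 < x) :
    x / (x + 1) / (1 - x / (x + 1)) = x := by
  have h : x + 1 ≠ 0 := by positivity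
  have h' : 1 - x / (x + 1) = 1 / (x + 1) := by field_simp; ring
  rw [h']
  field_simp

theorem div_one_sub_div_add_one {z : ℝ} (hz : z < 1) :
    z / (1 - z) / (z / (1 - z) + 1) = z := by
  have h : 1 - z ≠ 0 := by linarith
  have h' : z / (1 - z) + 1 = 1 / (1 - z) := by field_simp; ring
  rw [h']
  field_simp

theorem bijOn_div_add_one :
    Set.BijOn (fun x : ℝ => x / (x + 1)) {z : ℝ | 0 < z ∧ Irrational z}
      {z : ℝ | 0 < z ∧ z < 1 ∧ Irrational z} := by
  refine Set.InvOn.bijOn (f' := fun z => z / (1 - z))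
    ⟨fun x hx => div_add_one_div_one_sub hx.1, fun z hz => div_one_sub_div_add_one hz.2.1⟩ ?_ ?_
  · rintro x ⟨hx, hirr⟩
    refine ⟨by positivity, (div_lt_one (by linarith)).2 (by linarith), ?_⟩
    rintro ⟨r, hr⟩
    exact hirr ⟨r / (1 - r), by push_cast; rw [hr]; exact div_add_one_div_one_sub hx⟩
  · rintro z ⟨hz, hz1, hirr⟩
    refine ⟨div_pos hz (by linarith), ?_⟩
    rintro ⟨r, hr⟩
    exact hirr ⟨r / (r + 1), by push_cast; rw [hr]; exact div_one_sub_div_add_one hz1⟩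

/-- The map `x ↦ x/(x+1)` is a bijective isometry from the positive irrationals with the
metric `d` onto the irrationals of `(0,1)` with the metric `δ`. -/
theorem map_isometry_dmet_deltamet :
    (∀ x y : ℝ, Irrational x → Irrational y → 0 < x → x < y →
      deltamet (x / (x + 1)) (y / (y + 1)) = dmet x y) ∧
    (∀ x y : ℝ, x ∈ {z : ℝ | 0 < z ∧ Irrational z} → y ∈ {z : ℝ | 0 < z ∧ Irrational z} →
      deltamet (x / (x + 1)) (y / (y + 1)) = dmet x y) ∧
    Set.BijOn (fun x : ℝ => x / (x + 1)) {z : ℝ | 0 < z ∧ Irrational z}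
      {z : ℝ | 0 < z ∧ z < 1 ∧ Irrational z} := by
  refine ⟨fun x y _ _ hx hxy => deltamet_div_add_one hx hxy, ?_, bijOn_div_add_one⟩
  rintro x y ⟨hx, -⟩ ⟨hy, -⟩
  rcases lt_trichotomy x y with h | rfl | h
  · exact deltamet_div_add_one hx h
  · simp [deltamet, dmet]
  · rw [deltamet_comm, dmet_comm, deltamet_div_add_one hy h]
end
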